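/- arXiv:2509.06209 — 6 statements merged into one kernel-verified Lean document; each statement's English description precedes it below -/
import Mathlib

section
/- Let n ≥ 1 and let E : Fin n → Fin n → Prop be a directed graph. There exists a directed graph E' : (Fin n × Fin n) → (Fin n × Fin n) → Prop such that: (i) every vertex w has at most 2 in-neighbors, i.e., the set {u : E' u w} has cardinality at most 2; (ii) for all s, t : Fin n, Relation.ReflTransGen E s t holds if and only if Relation.ReflTransGen E' (s, 0) (t, 0) holds; and (iii) for all s, t : Fin n and every natural number L, if there is an E-walk of length L from s to t (a function w : Fin (L+1) → Fin n with w 0 = s, w L = t, and E (w i) (w (i+1)) for all i < L), then there is an E'-walk from (s, 0) to (t, 0) of some length at most L · (Nat.clog 2 n + 1). -/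
def HasWalk {α : Type*} (R : α → α → Prop) : ℕ → α → α → Prop
  | 0, a, b => a = b
  | L + 1, a, b => ∃ c, R a c ∧ HasWalk R L c b

theorem HasWalk.append {α : Type*} {R : α → α → Prop} {L M : ℕ} {a b c : α}
    (h : HasWalk R L a b) (h' : HasWalk R M b c) : HasWalk R (L + M) a c := by
  induction L generalizing a with
  | zero => cases h; simpa using h'
  | succ L ih =>
    obtain ⟨d, hd, h⟩ := h
    rw [Nat.succ_add]
    exact ⟨d, hd, ih h⟩

theorem HasWalk.reach {α : Type*} {R : α → α → Prop} {L : ℕ} {a b : α}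
    (h : HasWalk R L a b) : Relation.ReflTransGen R a b := by
  induction L generalizing a with
  | zero => cases h; exact .refl
  | succ L ih =>
    obtain ⟨d, hd, h⟩ := h
    exact .head hd (ih h)

theorem HasWalk.toFun {α : Type*} {R : α → α → Prop} {L : ℕ} {a b : α}
    (h : HasWalk R L a b) : ∃ w : Fin (L + 1) → α, w 0 = a ∧ w (Fin.last L) = b ∧
      ∀ i : Fin L, R (w i.castSucc) (w i.succ) := by
  induction L generalizing a with
  | zero => exact ⟨fun _ => a, rfl, h, fun i => i.elim0⟩
  | succ L ih =>
    obtain ⟨d, hd, h⟩ := h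
    obtain ⟨w, h0, hl, hw⟩ := ih h
    refine ⟨Fin.cons a w, by simp, ?_, ?_⟩
    · rw [← Fin.succ_last, Fin.cons_succ, hl]
    · intro i
      refine Fin.cases ?_ (fun j => ?_) i
      · simpa [h0] using hd
      · rw [← Fin.succ_castSucc, Fin.cons_succ, Fin.cons_succ]
        exact hw j

/-- Heap edges: slot `k` feeds the node with heap index `k / 2`. -/
def heapSlot (n : ℕ) (E : Fin n → Fin n → Prop) (k : ℕ) (x y : Fin n × Fin n) : Prop :=
  (x.1 = y.1 ∧ x.2.val + 1 = k) ∨ (x.2.val = 0 ∧ x.1.val + n + 1 = k ∧ E x.1 y.1)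

def heapE (n : ℕ) (E : Fin n → Fin n → Prop) (x y : Fin n × Fin n) : Prop :=
  ∃ k, k / 2 = y.2.val + 1 ∧ heapSlot n E k x y

theorem heapSlot_card (n : ℕ) (E : Fin n → Fin n → Prop) (k : ℕ) (y : Fin n × Fin n) :
    Set.ncard {x | heapSlot n E k x y} ≤ 1 := by
  rw [Set.ncard_le_one_iff]
  rintro ⟨a, i⟩ ⟨b, j⟩ h h'
  simp only [Set.mem_ofPred_eq, heapSlot] at h h'
  have := i.isLt
  have := j.isLt
  rw [Prod.mk.injEq, Fin.ext_iff, Fin.ext_iff]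
  rcases h with ⟨h1, h2⟩ | ⟨h1, h2, -⟩ <;> rcases h' with ⟨h3, h4⟩ | ⟨h3, h4, -⟩
  · rw [h1, h3]; exact ⟨rfl, by omega⟩
  · omega
  · omega
  · omega

theorem heapE_card (n : ℕ) (E : Fin n → Fin n → Prop) (y : Fin n × Fin n) :
    Set.ncard {x | heapE n E x y} ≤ 2 := by
  have hsub : {x | heapE n E x y} ⊆ {x | heapSlot n E (2 * (y.2.val + 1)) x y} ∪
      {x | heapSlot n E (2 * (y.2.val + 1) + 1) x y} := by
    rintro x ⟨k, hk, h⟩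
    have : k = 2 * (y.2.val + 1) ∨ k = 2 * (y.2.val + 1) + 1 := by omega
    rcases this with rfl | rfl
    · exact Or.inl h
    · exact Or.inr h
  have h1 := Set.ncard_le_ncard hsub (Set.toFinite _)
  have h2 := Set.ncard_union_le {x | heapSlot n E (2 * (y.2.val + 1)) x y}
      {x | heapSlot n E (2 * (y.2.val + 1) + 1) x y}
  have h3 := heapSlot_card n E (2 * (y.2.val + 1)) y
  have h4 := heapSlot_card n E (2 * (y.2.val + 1) + 1) y
  omega

theorem heap_climb (n : ℕ) (hn : 1 ≤ n) (E : Fin n → Fin n → Prop) (v : Fin n) (j : ℕ) :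
    ∀ hj : j < n, HasWalk (heapE n E) (Nat.log 2 (j + 1)) (v, ⟨j, hj⟩) (v, ⟨0, hn⟩) := by
  induction j using Nat.strong_induction_on with
  | _ j ih =>
    intro hj
    rcases Nat.eq_zero_or_pos j with rfl | hpos
    · simp [HasWalk]
    · have h2 : (j + 1) / 2 = (j - 1) / 2 + 1 := by omega
      rw [Nat.log_of_one_lt_of_le (by norm_num) (by omega), h2]
      exact ⟨(v, ⟨(j - 1) / 2, by omega⟩), ⟨j + 1, h2, Or.inl ⟨rfl, rfl⟩⟩,
        ih _ (by omega) (by omega)⟩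

theorem heap_edge (n : ℕ) (hn : 1 ≤ n) (E : Fin n → Fin n → Prop) (u v : Fin n) (h : E u v) :
    ∃ M ≤ Nat.clog 2 n + 1, HasWalk (heapE n E) M (u, ⟨0, hn⟩) (v, ⟨0, hn⟩) := by
  have hu := u.isLt
  have h2 : (u.val + n + 1) / 2 = (u.val + n - 1) / 2 + 1 := by omega
  refine ⟨Nat.log 2 ((u.val + n - 1) / 2 + 1) + 1, ?_, (v, ⟨(u.val + n - 1) / 2, by omega⟩),
    ⟨u.val + n + 1, h2, Or.inr ⟨rfl, rfl, h⟩⟩, heap_climb n hn E v _ _⟩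
  have : Nat.log 2 ((u.val + n - 1) / 2 + 1) ≤ Nat.log 2 n := Nat.log_mono_right (by omega)
  have := Nat.log_le_clog 2 n
  omega

theorem heap_proj (n : ℕ) (E : Fin n → Fin n → Prop) (x y : Fin n × Fin n)
    (h : Relation.ReflTransGen (heapE n E) x y) : Relation.ReflTransGen E x.1 y.1 := by
  induction h with
  | refl => exact .refl
  | tail _ h ih =>
    obtain ⟨k, -, ⟨h, -⟩ | ⟨-, -, h⟩⟩ := h
    · rwa [← h]
    · exact ih.tail h

theorem indegree_reduction (n : ℕ) (hn : 1 ≤ n) (E : Fin n → Fin n → Prop) :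
    ∃ E' : (Fin n × Fin n) → (Fin n × Fin n) → Prop,
      (∀ w : Fin n × Fin n, Set.ncard {u | E' u w} ≤ 2) ∧
      (∀ s t : Fin n,
        Relation.ReflTransGen E s t ↔
          Relation.ReflTransGen E' (s, ⟨0, hn⟩) (t, ⟨0, hn⟩)) ∧
      (∀ s t : Fin n, ∀ L : ℕ, ∀ w : Fin (L + 1) → Fin n,
        w 0 = s → w (Fin.last L) = t →
        (∀ i : Fin L, E (w i.castSucc) (w i.succ)) →
        ∃ L' ≤ L * (Nat.clog 2 n + 1), ∃ w' : Fin (L' + 1) → Fin n × Fin n,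
          w' 0 = (s, ⟨0, hn⟩) ∧ w' (Fin.last L') = (t, ⟨0, hn⟩) ∧
          ∀ i : Fin L', E' (w' i.castSucc) (w' i.succ)) := by
  refine ⟨heapE n E, heapE_card n E, fun s t => ⟨fun h => ?_, fun h => heap_proj n E _ _ h⟩, ?_⟩
  · induction h with
    | refl => exact .refl
    | tail _ h ih =>
      obtain ⟨M, -, hM⟩ := heap_edge n hn E _ _ h
      exact ih.trans hM.reach
  · intro s t L w h0 hl hw
    suffices h : ∃ M ≤ L * (Nat.clog 2 n + 1), HasWalk (heapE n E) M (s, ⟨0, hn⟩) (t, ⟨0, hn⟩) by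
      obtain ⟨M, hM, h⟩ := h
      exact ⟨M, hM, h.toFun⟩
    induction L generalizing s with
    | zero => exact ⟨0, by simp, by rw [← h0, ← hl]; rfl⟩
    | succ L ih =>
      obtain ⟨M, hM, h⟩ := ih (w 1) (fun i => w i.succ) rfl hl (fun i => hw i.succ)
      obtain ⟨M', hM', h'⟩ := heap_edge n hn E _ _ (hw 0)
      subst h0
      refine ⟨M' + M, ?_, HasWalk.append h' h⟩
      rw [Nat.succ_mul]
      omega
end

section
/- Let n = Fintype.card V with n ≥ 1, let s, t : V, and suppose E t t (there is a self-loop at t). Then 0 < W_E n s t if and only if Relation.ReflTransGen E s t; that is, the number of directed walks of length exactly n from s to t is nonzero if and only if t is reachable from s. -/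
theorem walk_count_pos_iff_reachable {V : Type*} [Fintype V] [DecidableEq V]
    (E : V → V → Prop) [DecidableRel E]
    (W : ℕ → V → V → ℕ)
    (hW0 : ∀ u v, W 0 u v = if u = v then 1 else 0)
    (hWs : ∀ i u v, W (i + 1) u v = ∑ w ∈ Finset.univ.filter (fun w => E w v), W i u w)
    (hn : 1 ≤ Fintype.card V) (s t : V) (ht : E t t) :
    0 < W (Fintype.card V) s t ↔ Relation.ReflTransGen E s t := by
  classical
  have pos_succ : ∀ i v, 0 < W (i + 1) s v ↔ ∃ w, E w v ∧ 0 < W i s w := by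
    intro i v
    rw [hWs, Finset.sum_pos_iff]
    simp
  have h0 : 0 < W 0 s s := by simp [hW0]
  have sound : ∀ i v, 0 < W i s v → Relation.ReflTransGen E s v := by
    intro i
    induction i with
    | zero =>
      intro v h
      by_cases hsv : s = v
      · rw [hsv]
      · simp [hW0, hsv] at h
    | succ i ih =>
      intro v h
      obtain ⟨w, hw, hp⟩ := (pos_succ i v).1 h
      exact (ih w hp).tail hw
  refine ⟨sound _ t, fun hst => ?_⟩
  let R : ℕ → Finset V := fun k => Finset.univ.filter (fun v => ∃ j ≤ k, 0 < W j s v)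
  have memR : ∀ k v, v ∈ R k ↔ ∃ j ≤ k, 0 < W j s v := by
    intro k v
    simp [R]
  have mono : ∀ k, R k ⊆ R (k + 1) := by
    intro k v hv
    obtain ⟨j, hj, hp⟩ := (memR k v).1 hv
    exact (memR _ v).2 ⟨j, by omega, hp⟩
  have key : ∀ k, (∀ v, Relation.ReflTransGen E s v → v ∈ R k) ∨ k + 1 ≤ (R k).card := by
    intro k
    induction k with
    | zero =>
      right
      exact Finset.card_pos.2 ⟨s, (memR 0 s).2 ⟨0, le_rfl, h0⟩⟩
    | succ k ih =>
      rcases ih with h | h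
      · exact Or.inl fun v hv => mono k (h v hv)
      · by_cases heq : R k = R (k + 1)
        · left
          intro v hv
          rw [← heq]
          induction hv with
          | refl => exact (memR k s).2 ⟨0, Nat.zero_le _, h0⟩
          | @tail b c _ hbc ihb =>
            obtain ⟨j, hj, hp⟩ := (memR k b).1 ihb
            rw [heq]
            exact (memR _ c).2 ⟨j + 1, by omega, (pos_succ j c).2 ⟨b, hbc, hp⟩⟩
        · right
          have := Finset.card_lt_card ((mono k).ssubset_of_ne heq)
          omega
  have hR : t ∈ R (Fintype.card V) := by
    rcases key (Fintype.card V) with h | h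
    · exact h t hst
    · have := Finset.card_le_univ (R (Fintype.card V))
      omega
  obtain ⟨j, hj, hp⟩ := (memR _ t).1 hR
  exact Nat.le_induction (P := fun m _ => 0 < W m s t) hp
    (fun m _ h => (pos_succ m t).2 ⟨t, ht, h⟩) _ hj
end

section
/- Let ℓ, d, τ, N be natural numbers with 1 ≤ d, τ < 2^ℓ, and N ≤ 2^ℓ. For k < d let c_k denote the cardinality of {t ∈ Finset.range N : ((τ + t) % 2^ℓ) % d = k}. Then for all k, k' < d, the counts differ by at most 2: |(c_k : ℤ) − (c_{k'} : ℤ)| ≤ 2. -/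
theorem cf_count (d k : ℕ) (hk : k < d) (m : ℕ) :
    Nat.count (fun x => x % d = k) m = m / d + if k < m % d then 1 else 0 := by
  have h := Nat.count_modEq_card m (r := d) (by omega) k
  simpa only [Nat.ModEq, Nat.mod_eq_of_lt hk] using h

theorem cf_nowrap (M d τ k : ℕ) (N : ℕ) (h : τ + N ≤ M) :
    Nat.count (fun x => x % d = k) τ + Nat.count (fun t => ((τ + t) % M) % d = k) N
      = Nat.count (fun x => x % d = k) (τ + N) := by
  induction N with
  | zero => simp
  | succ n ih =>
    have h1 := ih (by omega)
    rw [← add_assoc, Nat.count_succ, Nat.count_succ, ← h1, Nat.mod_eq_of_lt (show τ + n < M by omega)]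
    omega

theorem cf_wrap (M d τ k : ℕ) (hτ : τ < M) (j : ℕ) (h : j ≤ M) :
    Nat.count (fun x => x % d = k) τ + Nat.count (fun t => ((τ + t) % M) % d = k) (M - τ + j)
      = Nat.count (fun x => x % d = k) M + Nat.count (fun x => x % d = k) j := by
  induction j with
  | zero =>
    have := cf_nowrap M d τ k (M - τ) (by omega)
    rw [show τ + (M - τ) = M by omega] at this
    simpa using this
  | succ n ih =>
    have h1 := ih (by omega)
    have h2 : (τ + (M - τ + n)) % M = n := by
      rw [show τ + (M - τ + n) = n + M by omega, Nat.add_mod_right, Nat.mod_eq_of_lt (by omega)]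
    rw [← add_assoc, Nat.count_succ, Nat.count_succ, h2]
    omega

theorem counter_fairness (ℓ d τ N : ℕ) (hd : 1 ≤ d) (hτ : τ < 2 ^ ℓ) (hN : N ≤ 2 ^ ℓ)
    (k k' : ℕ) (hk : k < d) (hk' : k' < d) :
    |(((Finset.range N).filter (fun t => ((τ + t) % 2 ^ ℓ) % d = k)).card : ℤ)
      - (((Finset.range N).filter (fun t => ((τ + t) % 2 ^ ℓ) % d = k')).card : ℤ)| ≤ 2 := by
  rw [← Nat.count_eq_card_filter_range, ← Nat.count_eq_card_filter_range]
  generalize 2 ^ ℓ = M at *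
  rw [abs_le]
  by_cases h : τ + N ≤ M
  · have h1 := cf_nowrap M d τ k N h
    have h2 := cf_nowrap M d τ k' N h
    rw [cf_count d _ hk, cf_count d _ hk] at h1
    rw [cf_count d _ hk', cf_count d _ hk'] at h2
    generalize (τ + N) % d = r1 at *
    generalize (τ + N) / d = q1 at *
    generalize τ % d = r2 at *
    generalize τ / d = q2 at *
    split_ifs at h1 h2 <;> omega
  · obtain ⟨j, rfl⟩ : ∃ j, N = M - τ + j := ⟨N - (M - τ), by omega⟩
    have h1 := cf_wrap M d τ k hτ j (by omega)
    have h2 := cf_wrap M d τ k' hτ j (by omega)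
    rw [cf_count d _ hk, cf_count d _ hk, cf_count d _ hk] at h1
    rw [cf_count d _ hk', cf_count d _ hk', cf_count d _ hk'] at h2
    generalize M % d = r1 at *
    generalize M / d = q1 at *
    generalize τ % d = r2 at *
    generalize τ / d = q2 at *
    generalize j % d = r3 at *
    generalize j / d = q3 at *
    split_ifs at h1 h2 <;> omega
end

section
/- Let (d, nbr) be a topologically ordered out-indexed DAG on Fin n with edge count m = Σ_v d v, and let K : ℕ. Suppose N : Fin n → ℕ and C : (v : Fin n) → Fin (d v) → ℕ satisfy: (i) N 0 = K, and for every w ≠ 0, N w = Σ over pairs (v, r) with nbr v r = w of C v r; (ii) for every v with d v > 0, Σ over r : Fin (d v) of C v r = N v; (iii) for every v and all r, r' : Fin (d v), |(C v r : ℤ) − (C v r' : ℤ)| ≤ 2. Suppose p : Fin n → ℝ satisfies p 0 = 1 and, for every w ≠ 0, p w = Σ over pairs (v, r) with nbr v r = w of p v / d v. Then for every vertex v : Fin n, |(N v : ℝ) − K · p v| ≤ 2 · m. -/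
theorem visit_counts_accurate (n : ℕ) (hn : 1 ≤ n)
    (d : Fin n → ℕ) (nbr : (v : Fin n) → Fin (d v) → Fin n)
    (hmono : ∀ (v : Fin n) (r : Fin (d v)), v < nbr v r)
    (K : ℕ) (N : Fin n → ℕ) (C : (v : Fin n) → Fin (d v) → ℕ)
    (hN0 : N ⟨0, hn⟩ = K)
    (hNin : ∀ w : Fin n, w ≠ ⟨0, hn⟩ →
      N w = ∑ v : Fin n, ∑ r ∈ Finset.univ.filter (fun r => nbr v r = w), C v r)
    (hCsum : ∀ v : Fin n, 0 < d v → ∑ r : Fin (d v), C v r = N v)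
    (hfair : ∀ (v : Fin n) (r r' : Fin (d v)), |(C v r : ℤ) - (C v r' : ℤ)| ≤ 2)
    (p : Fin n → ℝ)
    (hp0 : p ⟨0, hn⟩ = 1)
    (hpin : ∀ w : Fin n, w ≠ ⟨0, hn⟩ →
      p w = ∑ v : Fin n, ∑ r ∈ Finset.univ.filter (fun r => nbr v r = w), p v / d v)
    (v : Fin n) :
    |(N v : ℝ) - K * p v| ≤ 2 * (∑ u : Fin n, d u) := by
  have hfr : ∀ (v : Fin n) (r r' : Fin (d v)), |(C v r : ℝ) - C v r'| ≤ 2 := by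
    intro v r r'
    exact_mod_cast hfair v r r'
  obtain ⟨f, hf⟩ : ∃ f : (v : Fin n) → Fin (d v) → ℝ,
      ∀ v r, f v r = C v r - K * (p v / d v) := ⟨_, fun _ _ => rfl⟩
  -- absolute incoming error bounds the vertex error
  have hI : ∀ w : Fin n, |(N w : ℝ) - K * p w| ≤
      ∑ v : Fin n, ∑ r : Fin (d v), if nbr v r = w then |f v r| else 0 := by
    intro w
    by_cases hw : w = ⟨0, hn⟩
    · rw [hw, hN0, hp0]
      simp only [mul_one, sub_self, abs_zero]
      refine Finset.sum_nonneg fun v _ => Finset.sum_nonneg fun r _ => ?_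
      split_ifs <;> positivity
    · have h1 : (N w : ℝ) - K * p w =
          ∑ v : Fin n, ∑ r : Fin (d v), if nbr v r = w then f v r else 0 := by
        rw [hNin w hw, hpin w hw]
        push_cast
        rw [Finset.mul_sum, ← Finset.sum_sub_distrib]
        refine Finset.sum_congr rfl fun v _ => ?_
        rw [Finset.mul_sum, ← Finset.sum_sub_distrib, Finset.sum_filter]
        refine Finset.sum_congr rfl fun r _ => ?_
        rw [hf]
      rw [h1]
      refine (Finset.abs_sum_le_sum_abs _ _).trans (Finset.sum_le_sum fun v _ => ?_)
      refine (Finset.abs_sum_le_sum_abs _ _).trans (Finset.sum_le_sum fun r _ => ?_)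
      split_ifs <;> simp
  -- outgoing error
  have hO : ∀ u : Fin n, ∑ r : Fin (d u), |f u r| ≤ |(N u : ℝ) - K * p u| + 2 * d u := by
    intro u
    rcases Nat.eq_zero_or_pos (d u) with h0 | hpos
    · have : IsEmpty (Fin (d u)) := by rw [h0]; infer_instance
      rw [Finset.univ_eq_empty, Finset.sum_empty]
      positivity
    · have hd : (0 : ℝ) < d u := by exact_mod_cast hpos
      have hs : (N u : ℝ) = ∑ r : Fin (d u), (C u r : ℝ) := by
        rw [← hCsum u hpos]; push_cast; rfl
      have he : ∀ r, |(C u r : ℝ) - N u / d u| ≤ 2 := by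
        intro r
        have h2 : (C u r : ℝ) - N u / d u = (∑ r' : Fin (d u), ((C u r : ℝ) - C u r')) / d u := by
          rw [Finset.sum_sub_distrib, ← hs]
          simp
          field_simp
        rw [h2, abs_div, abs_of_pos hd, div_le_iff₀ hd]
        refine (Finset.abs_sum_le_sum_abs _ _).trans ?_
        refine (Finset.sum_le_sum fun r' _ => hfr u r r').trans ?_
        simp [mul_comm]
      have hb : ∀ r, |f u r| ≤ |(N u : ℝ) - K * p u| / d u + 2 := by
        intro r
        have h3 : f u r = ((N u : ℝ) - K * p u) / d u + ((C u r : ℝ) - N u / d u) := by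
          rw [hf]; ring
        rw [h3]
        refine (abs_add_le _ _).trans ?_
        rw [abs_div, abs_of_pos hd]
        linarith [he r]
      refine (Finset.sum_le_sum fun r _ => hb r).trans (le_of_eq ?_)
      simp
      field_simp
  have hS : ∀ k : ℕ, k ≤ n →
      (∑ v : Fin n, ∑ r : Fin (d v), if v.val < k ∧ k ≤ (nbr v r).val then |f v r| else 0) ≤
        ∑ v : Fin n, if v.val < k then 2 * (d v : ℝ) else 0 := by
    intro k
    induction k with
    | zero => intro _; simp
    | succ k ih =>
      intro hk
      have ih := ih (by omega)
      have hk' : k < n := hk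
      have hA : (∑ v : Fin n, ∑ r : Fin (d v),
            if v.val < k + 1 ∧ k + 1 ≤ (nbr v r).val then |f v r| else 0) +
          (∑ v : Fin n, ∑ r : Fin (d v), if nbr v r = ⟨k, hk'⟩ then |f v r| else 0) =
          (∑ v : Fin n, ∑ r : Fin (d v),
            if v.val < k ∧ k ≤ (nbr v r).val then |f v r| else 0) +
          ∑ v : Fin n, if v = ⟨k, hk'⟩ then ∑ r : Fin (d v), |f v r| else 0 := by
        rw [← Finset.sum_add_distrib, ← Finset.sum_add_distrib]
        refine Finset.sum_congr rfl fun v _ => ?_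
        have : (if v = ⟨k, hk'⟩ then ∑ r : Fin (d v), |f v r| else 0) =
            ∑ r : Fin (d v), if v = ⟨k, hk'⟩ then |f v r| else 0 := by
          split_ifs <;> simp
        rw [this, ← Finset.sum_add_distrib, ← Finset.sum_add_distrib]
        refine Finset.sum_congr rfl fun r _ => ?_
        have hm : v.val < (nbr v r).val := hmono v r
        simp only [Fin.ext_iff]
        split_ifs <;> first | omega | simp
      have hB : (∑ v : Fin n, if v.val < k + 1 then 2 * (d v : ℝ) else 0) =
          (∑ v : Fin n, if v.val < k then 2 * (d v : ℝ) else 0) +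
          ∑ v : Fin n, if v = ⟨k, hk'⟩ then 2 * (d v : ℝ) else 0 := by
        rw [← Finset.sum_add_distrib]
        refine Finset.sum_congr rfl fun v _ => ?_
        simp only [Fin.ext_iff]
        split_ifs <;> first | omega | simp
      rw [Finset.sum_ite_eq' Finset.univ (⟨k, hk'⟩ : Fin n)] at hA hB
      simp only [Finset.mem_univ, if_true] at hA hB
      have := hI ⟨k, hk'⟩
      have := hO ⟨k, hk'⟩
      linarith
  refine (hI v).trans (le_trans ?_ ((hS v.val v.isLt.le).trans ?_))
  · refine Finset.sum_le_sum fun u _ => Finset.sum_le_sum fun r _ => ?_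
    have hm : u.val < (nbr u r).val := hmono u r
    simp only [Fin.ext_iff]
    split_ifs <;> first | omega | simp
  · push_cast
    rw [Finset.mul_sum]
    refine Finset.sum_le_sum fun u _ => ?_
    split_ifs
    · exact le_rfl
    · positivity
end

section
/- Let (d, nbr) be a topologically ordered out-indexed DAG on Fin n and let L ≥ 1. Then for every register configuration R : Fin n → ZMod L and every start vertex v : Fin n, revWalk (fwdWalk R v).2 v = ((fwdWalk R v).1, R); that is, running the reverse walk from v on the registers produced by the forward walk from v visits exactly the same sequence of vertices and restores the registers to their original configuration R. -/
def fwdWalk {n : ℕ} (d : Fin n → ℕ) (nbr : (v : Fin n) → Fin (d v) → Fin n)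
    (hmono : ∀ (v : Fin n) (r : Fin (d v)), v < nbr v r)
    {L : ℕ} (R : Fin n → ZMod L) (v : Fin n) : List (Fin n) × (Fin n → ZMod L) :=
  if h : d v = 0 then ([v], R)
  else
    let r : Fin (d v) := ⟨(R v).val % d v, Nat.mod_lt _ (Nat.pos_of_ne_zero h)⟩
    let R' := Function.update R v (R v + 1)
    let res := fwdWalk d nbr hmono R' (nbr v r)
    (v :: res.1, res.2)
termination_by n - v.val
decreasing_by exact Nat.sub_lt_sub_left v.isLt (hmono v _)

def revWalk {n : ℕ} (d : Fin n → ℕ) (nbr : (v : Fin n) → Fin (d v) → Fin n)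
    (hmono : ∀ (v : Fin n) (r : Fin (d v)), v < nbr v r)
    {L : ℕ} (R : Fin n → ZMod L) (v : Fin n) : List (Fin n) × (Fin n → ZMod L) :=
  if h : d v = 0 then ([v], R)
  else
    let R' := Function.update R v (R v - 1)
    let r : Fin (d v) := ⟨(R' v).val % d v, Nat.mod_lt _ (Nat.pos_of_ne_zero h)⟩
    let res := revWalk d nbr hmono R' (nbr v r)
    (v :: res.1, res.2)
termination_by n - v.val
decreasing_by exact Nat.sub_lt_sub_left v.isLt (hmono v _)

theorem fwdWalk_apply_lt {n : ℕ} (d : Fin n → ℕ) (nbr : (v : Fin n) → Fin (d v) → Fin n)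
    (hmono : ∀ (v : Fin n) (r : Fin (d v)), v < nbr v r) {L : ℕ} (v : Fin n) :
    ∀ (R : Fin n → ZMod L) (u : Fin n), u < v → (fwdWalk d nbr hmono R v).2 u = R u := by
  induction v using WellFoundedGT.induction with
  | ind v ih =>
    intro R u hu
    rw [fwdWalk]
    split_ifs with h
    · rfl
    · dsimp only
      rw [ih _ (hmono v _) _ u (hu.trans (hmono v _)), Function.update_of_ne hu.ne]

theorem revWalk_update_lt {n : ℕ} (d : Fin n → ℕ) (nbr : (v : Fin n) → Fin (d v) → Fin n)
    (hmono : ∀ (v : Fin n) (r : Fin (d v)), v < nbr v r) {L : ℕ} (v : Fin n) :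
    ∀ (R : Fin n → ZMod L) (u : Fin n) (a : ZMod L), u < v →
      revWalk d nbr hmono (Function.update R u a) v
        = ((revWalk d nbr hmono R v).1,
            Function.update (revWalk d nbr hmono R v).2 u a) := by
  induction v using WellFoundedGT.induction with
  | ind v ih =>
    intro R u a hu
    rw [revWalk, revWalk]
    split_ifs with h
    · rfl
    · simp only [Function.update_self, Function.update_of_ne hu.ne']
      have key : ∀ w, v < w → revWalk d nbr hmono
          (Function.update (Function.update R u a) v (R v - 1)) w
          = ((revWalk d nbr hmono (Function.update R v (R v - 1)) w).1,
            Function.update (revWalk d nbr hmono (Function.update R v (R v - 1)) w).2 u a) := by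
        intro w hw
        rw [Function.update_comm hu.ne, ih w hw _ u a (hu.trans hw)]
      rw [key _ (hmono v _)]

theorem revWalk_fwdWalk (n : ℕ) (d : Fin n → ℕ) (nbr : (v : Fin n) → Fin (d v) → Fin n)
    (hmono : ∀ (v : Fin n) (r : Fin (d v)), v < nbr v r)
    (L : ℕ) (hL : 1 ≤ L) (R : Fin n → ZMod L) (v : Fin n) :
    revWalk d nbr hmono (fwdWalk d nbr hmono R v).2 v
      = ((fwdWalk d nbr hmono R v).1, R) := by
  clear hL
  induction v using WellFoundedGT.induction generalizing R with
  | ind v ih =>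
    by_cases h : d v = 0
    · rw [fwdWalk, dif_pos h, revWalk, dif_pos h]
    · rw [fwdWalk, dif_neg h, revWalk, dif_neg h]
      simp only [Function.update_self, fwdWalk_apply_lt d nbr hmono _ _ _ (hmono v _),
        add_sub_cancel_right]
      rw [revWalk_update_lt d nbr hmono _ _ _ _ (hmono v _), ih _ (hmono v _)]
      simp
end

section
/- Let W be a column-stochastic matrix on Fin n, let π : Fin n → ℝ, let ε, δ : ℝ, and let T ≥ 1 be a natural number. Suppose W mixes in time T with error ε: for every probability vector x : Fin n → ℝ, Σ_i |((W^T).mulVec x) i − π i| ≤ ε, where W^T is the T-th matrix power. Suppose c : Fin n → ℝ is a probability vector satisfying Σ_i |c i − (W.mulVec c) i| ≤ δ / T. Then Σ_i |c i − π i| ≤ ε + δ. -/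
lemma l1_contract {n : ℕ} (W : Matrix (Fin n) (Fin n) ℝ)
    (hnonneg : ∀ i j, 0 ≤ W i j) (hcol : ∀ j, ∑ i, W i j = 1) (x : Fin n → ℝ) :
    ∑ i, |W.mulVec x i| ≤ ∑ i, |x i| := by
  calc ∑ i, |W.mulVec x i| ≤ ∑ i, ∑ j, W i j * |x j| := by
        refine Finset.sum_le_sum fun i _ => ?_
        simp only [Matrix.mulVec, dotProduct]
        refine le_trans (Finset.abs_sum_le_sum_abs _ _) (le_of_eq ?_)
        refine Finset.sum_congr rfl fun j _ => ?_
        rw [abs_mul, abs_of_nonneg (hnonneg i j)]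
    _ = ∑ j, |x j| := by
        rw [Finset.sum_comm]
        refine Finset.sum_congr rfl fun j _ => ?_
        rw [← Finset.sum_mul, hcol, one_mul]

lemma l1_iterate {n : ℕ} (W : Matrix (Fin n) (Fin n) ℝ)
    (hnonneg : ∀ i j, 0 ≤ W i j) (hcol : ∀ j, ∑ i, W i j = 1) (c : Fin n → ℝ) (k : ℕ) :
    ∑ i, |c i - (W ^ k).mulVec c i| ≤ k * ∑ i, |c i - W.mulVec c i| := by
  induction k with
  | zero => simp
  | succ k ih =>
    have h := l1_contract W hnonneg hcol (c - (W ^ k).mulVec c)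
    rw [Matrix.mulVec_sub, Matrix.mulVec_mulVec, ← pow_succ'] at h
    simp only [Pi.sub_apply] at h
    have h2 : ∑ i, |c i - (W ^ (k + 1)).mulVec c i| ≤ ∑ i, |c i - W.mulVec c i|
        + ∑ i, |W.mulVec c i - (W ^ (k + 1)).mulVec c i| := by
      rw [← Finset.sum_add_distrib]
      exact Finset.sum_le_sum fun i _ => abs_sub_le _ _ _
    push_cast
    linarith

theorem near_stationary_of_near_fixed {n : ℕ}
    (W : Matrix (Fin n) (Fin n) ℝ) (pi : Fin n → ℝ) (ε δ : ℝ)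
    (T : ℕ) (hT : 1 ≤ T)
    (hnonneg : ∀ i j, 0 ≤ W i j) (hcol : ∀ j, ∑ i, W i j = 1)
    (hmix : ∀ x : Fin n → ℝ, (∀ i, 0 ≤ x i) → ∑ i, x i = 1 →
      ∑ i, |(W ^ T).mulVec x i - pi i| ≤ ε)
    (c : Fin n → ℝ) (hc : ∀ i, 0 ≤ c i) (hcsum : ∑ i, c i = 1)
    (hclose : ∑ i, |c i - W.mulVec c i| ≤ δ / T) :
    ∑ i, |c i - pi i| ≤ ε + δ := by
  have h1 := hmix c hc hcsum
  have h2 := l1_iterate W hnonneg hcol c T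
  have hT' : (0 : ℝ) < T := by exact_mod_cast hT
  have h3 : (T : ℝ) * ∑ i, |c i - W.mulVec c i| ≤ δ := by
    rw [le_div_iff₀ hT'] at hclose
    linarith
  have h4 : ∑ i, |c i - pi i| ≤ ∑ i, |c i - (W ^ T).mulVec c i|
      + ∑ i, |(W ^ T).mulVec c i - pi i| := by
    rw [← Finset.sum_add_distrib]
    exact Finset.sum_le_sum fun i _ => abs_sub_le _ _ _
  linarith
end
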